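/- Let G be a finite graph with at least one edge, equipped with a transition system T such that each transition graph T(v) is connected. If G has no compatible closed trail (closed trail avoiding forbidden transitions), then G has a bridge. -/

import Mathlib

def CyclicCompatible {V : Type*} {G : SimpleGraph V}
    (T : V → Sym2 V → Sym2 V → Prop) {v : V} (C : G.Walk v v) : Prop :=
  List.Chain' (fun d₁ d₂ : G.Dart => T d₁.toProd.2 d₁.edge d₂.edge) C.darts ∧
  ∀ d ∈ C.darts.getLast?, ∀ d' ∈ C.darts.head?, T v d.edge d'.edge

namespace SimpleGraph

variable {V : Type*} {G : SimpleGraph V} {T : V → Sym2 V → Sym2 V → Prop}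

/-- Two darts may be traversed consecutively by a compatible trail. -/
def CompatibleStep (T : V → Sym2 V → Sym2 V → Prop) (d g : G.Dart) : Prop :=
  d.snd = g.fst ∧ T d.snd d.edge g.edge

/-- The list `L` of darts is a compatible trail that starts with `d` and ends with `m`. -/
structure IsCompatibleTrail (T : V → Sym2 V → Sym2 V → Prop) (d m : G.Dart)
    (L : List G.Dart) : Prop where
  chain : L.IsChain (CompatibleStep T)
  nodup : (L.map Dart.edge).Nodup
  head : d ∈ L.head?
  last : m ∈ L.getLast?

/-- Some compatible trail starts with the dart `d` and ends with the dart `m`. -/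
def TrailReach (T : V → Sym2 V → Sym2 V → Prop) (d m : G.Dart) : Prop :=
  ∃ L, IsCompatibleTrail T d m L

theorem CompatibleStep.symm (hT : ∀ v e f, T v e f → T v f e) {d d' : G.Dart}
    (h : CompatibleStep T d d') : CompatibleStep T d'.symm d.symm := by
  refine ⟨h.1.symm, ?_⟩
  have h2 := hT _ _ _ h.2
  rw [h.1] at h2
  simpa using h2

theorem TrailReach.refl (d : G.Dart) : TrailReach T d d :=
  ⟨[d], by simp, by simp, by simp, by simp⟩

theorem TrailReach.not_symm (d : G.Dart) : ¬ TrailReach T d d.symm := by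
  rintro ⟨L, -, hn, hh, hl⟩
  have h1 : d ∈ L := List.mem_of_mem_head? hh
  have h2 : d.symm ∈ L := List.mem_of_mem_getLast? hl
  exact d.symm_ne (List.inj_on_of_nodup_map hn h2 h1 (by simp))

/-- A list of darts that closes up to a compatible trail is the dart list of a circuit. -/
theorem exists_compatible_circuit_of_isChain {p : G.Dart} {L : List G.Dart}
    (hchain : (p :: L ++ [p]).IsChain (CompatibleStep T))
    (hn : ((p :: L).map Dart.edge).Nodup) :
    ∃ (v : V) (C : G.Walk v v), C.IsCircuit ∧ CyclicCompatible T C := by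
  rw [List.isChain_append] at hchain
  obtain ⟨hc, -, hl⟩ := hchain
  have hlast : CompatibleStep T ((p :: L).getLast (by simp)) p :=
    hl _ (List.getLast?_eq_some_getLast _) _ (by simp)
  obtain ⟨C, hC⟩ : ∃ C : G.Walk p.fst p.fst, C.darts = p :: L := by
    have hd : (p :: L).IsChain G.DartAdj := hc.imp fun _ _ h => h.1
    have key : ∀ (a b : V) (W : G.Walk a b), W.darts = p :: L → a = p.fst → b = p.fst →
        ∃ C : G.Walk p.fst p.fst, C.darts = p :: L := by
      rintro a b W hW rfl rfl
      exact ⟨W, hW⟩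
    exact key _ _ (Walk.ofDarts (p :: L) (by simp) hd) (Walk.darts_ofDarts _ _) rfl hlast.1
  refine ⟨p.fst, C, ⟨⟨by rwa [Walk.edges, hC]⟩, ?_⟩, ?_, ?_⟩
  · rintro rfl
    simp at hC
  · rw [hC]
    exact hc.imp fun _ _ h => h.2
  · rw [hC]
    intro d hd d' hd'
    rw [List.getLast?_eq_some_getLast (by simp)] at hd
    simp only [Option.mem_def, Option.some.injEq, List.head?_cons] at hd hd'
    subst hd hd'
    rw [← hlast.1]
    exact hlast.2

variable (T) in
/-- There is no compatible closed trail, in terms of lists of darts. -/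
def NoCompatibleCircuit (G : SimpleGraph V) : Prop :=
  ∀ (p : G.Dart) (L : List G.Dart), (p :: L ++ [p]).IsChain (CompatibleStep T) →
    ¬ ((p :: L).map Dart.edge).Nodup

theorem forall_not_or_exists_first_mem {α : Type*} (P : α → Prop) (L : List α) :
    (∀ x ∈ L, ¬ P x) ∨ ∃ L₁ q L₂, L = L₁ ++ q :: L₂ ∧ P q ∧ ∀ x ∈ L₁, ¬ P x := by
  induction L with
  | nil => simp
  | cons a L ih =>
    by_cases ha : P a
    · exact .inr ⟨[], a, L, by simp [ha]⟩
    · rcases ih with h | ⟨L₁, q, L₂, rfl, hq, h⟩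
      · left; simp_all
      · exact .inr ⟨a :: L₁, q, L₂, by simp_all⟩

/-- Without compatible closed trails, reachability by compatible trails can only fail to be
transitive at a dart whose reversal is reachable as well. -/
theorem TrailReach.trans_or (hT : ∀ v e f, T v e f → T v f e) (hG : NoCompatibleCircuit T G)
    {d m w : G.Dart} (hdm : TrailReach T d m) (hmw : TrailReach T m w) :
    TrailReach T d w ∨ TrailReach T d m.symm := by
  obtain ⟨P, hPc, hPn, hPh, hPl⟩ := hdm
  obtain ⟨Q', hQc, hQn, hQh, hQl⟩ := hmw
  obtain ⟨P', rfl⟩ : ∃ P', P = P' ++ [m] := by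
    simpa [eq_comm, List.getLast?_eq_some_iff] using hPl
  obtain ⟨Q, rfl⟩ : ∃ Q, Q' = m :: Q := List.head?_eq_some_iff.1 hQh
  have hPQ : (P' ++ [m] ++ Q).IsChain (CompatibleStep T) := hPc.append_overlap hQc (by simp)
  rcases forall_not_or_exists_first_mem (fun x => x.edge ∈ (P' ++ [m]).map Dart.edge) Q with
    h | ⟨Q₁, q, Q₂, rfl, hq, hQ₁⟩
  · refine .inl ⟨P' ++ [m] ++ Q, hPQ, ?_, ?_, ?_⟩
    · rw [List.map_append, List.nodup_append']
      refine ⟨hPn, hQn.of_cons, ?_⟩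
      intro e he he'
      obtain ⟨x, hx, rfl⟩ := List.mem_map.1 he'
      exact h x hx he
    · cases P' <;> simpa using hPh
    · simpa [List.getLast?_append, List.getLast?_cons] using hQl
  obtain ⟨p, hp, hpq⟩ := List.mem_map.1 hq
  obtain ⟨P₁, P₂, hP⟩ := List.append_of_mem hp
  rw [hP] at hPQ hPn hPc hPh hPl hQ₁
  rcases (dart_edge_eq_iff p q).1 hpq with rfl | rfl
  · exfalso
    refine hG p (P₂ ++ Q₁) (hPQ.infix ⟨P₁, Q₂, by simp⟩) ?_
    rw [← List.cons_append, List.map_append, List.nodup_append']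
    refine ⟨?_, ?_, ?_⟩
    · exact hPn.sublist (List.Sublist.map _ (by simp))
    · exact hQn.sublist (List.Sublist.map _ (by simp))
    · intro e he he'
      obtain ⟨x, hx, rfl⟩ := List.mem_map.1 he'
      exact hQ₁ x hx (by simp_all)
  · right
    have hrev : (q.symm :: Q₁.reverse.map Dart.symm ++ [m.symm]).IsChain (CompatibleStep T) := by
      have h1 : (m :: Q₁ ++ [q]).IsChain (CompatibleStep T) := hQc.infix ⟨[], Q₂, by simp⟩
      have h2 : (m :: Q₁ ++ [q]).reverse.IsChain fun a b => CompatibleStep T b a := by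
        rwa [List.isChain_reverse]
      have h3 := List.isChain_map_of_isChain (S := CompatibleStep T) Dart.symm
        (fun _ _ h => CompatibleStep.symm hT h) h2
      simpa using h3
    refine ⟨P₁ ++ q.symm :: (Q₁.reverse.map Dart.symm ++ [m.symm]), ?_, ?_, ?_, ?_⟩
    · have h1 : (P₁ ++ [q.symm]).IsChain (CompatibleStep T) := hPc.prefix ⟨P₂, by simp⟩
      simpa using h1.append_overlap hrev (by simp)
    · have hne : m ≠ q.symm := by
        rintro rfl
        simp at hQn
      have hm : m ∈ P₂ := by
        rw [List.getLast?_append, List.getLast?_cons] at hPl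
        cases hP₂ : P₂.getLast? with
        | none => simp [hP₂, hne.symm] at hPl
        | some x =>
          simp only [hP₂, Option.getD_some, Option.some_or, Option.mem_def,
            Option.some.injEq] at hPl
          exact hPl ▸ List.mem_of_mem_getLast? hP₂
      have hedges : (P₁ ++ q.symm :: (Q₁.reverse.map Dart.symm ++ [m.symm])).map Dart.edge =
          (P₁ ++ [q.symm]).map Dart.edge ++ ((m :: Q₁).map Dart.edge).reverse := by
        simp [Function.comp_def, List.map_reverse]
      rw [hedges, List.nodup_append']
      refine ⟨hPn.sublist (List.Sublist.map _ (by simp)),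
        List.nodup_reverse.2 (hQn.sublist (List.Sublist.map _ (by simp))), ?_⟩
      intro e he he'
      rw [List.mem_reverse] at he'
      obtain ⟨x, hx, rfl⟩ := List.mem_map.1 he'
      rcases List.mem_cons.1 hx with rfl | hx
      · have hsplit : P₁ ++ q.symm :: P₂ = (P₁ ++ [q.symm]) ++ P₂ := by simp
        rw [hsplit, List.map_append, List.nodup_append'] at hPn
        exact hPn.2.2 he (List.mem_map_of_mem hm)
      · refine hQ₁ x hx ?_
        simp only [List.map_append, List.mem_append, List.map_cons, List.mem_cons] at he ⊢
        tauto
    · cases P₁ <;> simpa using hPh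
    · rw [← List.cons_append, ← List.append_assoc]
      exact List.getLast?_concat

theorem IsCompatibleTrail.trailReach_of_mem {d m n : G.Dart} {L : List G.Dart}
    (h : IsCompatibleTrail T d m L) (hn : n ∈ L) : TrailReach T d n := by
  obtain ⟨L₁, L₂, rfl⟩ := List.append_of_mem hn
  refine ⟨L₁ ++ [n], h.chain.prefix ⟨L₂, by simp⟩,
    h.nodup.sublist (List.Sublist.map _ (by simp)), ?_, by simp⟩
  have := h.head
  cases L₁ <;> simpa using this

theorem IsCompatibleTrail.trailReach_of_step {d m n : G.Dart} {L : List G.Dart}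
    (h : IsCompatibleTrail T d m L) (hmn : CompatibleStep T m n)
    (hn : n.edge ∉ L.map Dart.edge) : TrailReach T d n := by
  refine ⟨L ++ [n], ?_, ?_, ?_, by simp⟩
  · refine h.chain.append (by simp) ?_
    intro x hx y hy
    obtain rfl := Option.mem_unique h.last hx
    simp only [List.head?_cons, Option.mem_def, Option.some.injEq] at hy
    exact hy ▸ hmn
  · rw [List.map_append, List.nodup_append']
    exact ⟨h.nodup, by simp, by simpa [List.disjoint_singleton] using hn⟩
  · have := h.head
    cases L <;> simp_all

theorem NoCompatibleCircuit.not_step {d m : G.Dart} (hG : NoCompatibleCircuit T G)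
    (h : TrailReach T d m) : ¬ CompatibleStep T m d := by
  intro hmd
  obtain ⟨L, hc, hn, hh, hl⟩ := h
  obtain ⟨L, rfl⟩ := List.head?_eq_some_iff.1 hh
  refine hG d L (hc.append (by simp) ?_) hn
  intro x hx y hy
  obtain rfl := Option.mem_unique hl hx
  simp only [List.head?_cons, Option.mem_def, Option.some.injEq] at hy
  exact hy ▸ hmd

theorem TrailReach.exists_step {m d : G.Dart} (h : TrailReach T m d) (hmd : m ≠ d) :
    ∃ n, TrailReach T m n ∧ CompatibleStep T n d := by
  obtain ⟨L, hL⟩ := h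
  obtain ⟨L, rfl⟩ := List.getLast?_eq_some_iff.1 hL.last
  rcases List.eq_nil_or_concat' L with rfl | ⟨L, n, rfl⟩
  · exact absurd (by simpa using hL.head) hmd.symm
  · exact ⟨n, hL.trailReach_of_mem (by simp),
      List.isChain_pair.1 (hL.chain.infix ⟨L, [], by simp⟩)⟩

/-- A dart that reaches the fewest darts reaches, together with any other dart, its reversal. -/
theorem exists_dart_forall_trailReach_symm [Finite V] (hT : ∀ v e f, T v e f → T v f e)
    (hG : NoCompatibleCircuit T G) [Nonempty G.Dart] :
    ∃ d : G.Dart, ∀ m, TrailReach T d m → m ≠ d → TrailReach T d m.symm := by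
  have : Finite G.Dart := Finite.of_injective _ Dart.toProd_injective
  obtain ⟨d, hd⟩ := Finite.exists_min fun d : G.Dart => {m | TrailReach T d m}.ncard
  refine ⟨d, fun m hm hmd => ?_⟩
  by_contra hs
  have hsub : {w | TrailReach T m w} ⊆ {w | TrailReach T d w} := fun w hw =>
    (hm.trans_or hT hG hw).resolve_right hs
  refine (hd m).not_gt (Set.ncard_lt_ncard ⟨hsub, fun hsub' => ?_⟩ (Set.toFinite _))
  have hmd' : TrailReach T m d := hsub' (TrailReach.refl d)
  obtain ⟨n, hn, hnd⟩ := hmd'.exists_step hmd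
  exact hG.not_step (hsub hn) hnd

theorem trailReach_of_transition {d m g : G.Dart}
    (hd : ∀ m, TrailReach T d m → m ≠ d → TrailReach T d m.symm)
    (hG : NoCompatibleCircuit T G) (hm : TrailReach T d m)
    (hmg : T m.snd m.edge g.edge) (hg : g.snd = m.snd) : TrailReach T d g := by
  have hstep : CompatibleStep T m g.symm := ⟨hg.symm, by simpa using hmg⟩
  have hgd : g.symm ≠ d := fun h => hG.not_step hm (h ▸ hstep)
  suffices h : TrailReach T d g ∨ TrailReach T d g.symm from
    h.elim id fun h => by simpa using hd _ h hgd
  obtain ⟨L, hL⟩ := hm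
  by_cases hmem : g.symm.edge ∈ L.map Dart.edge
  · obtain ⟨k, hk, hkg⟩ := List.mem_map.1 hmem
    have hdk := hL.trailReach_of_mem hk
    rcases (dart_edge_eq_iff k g.symm).1 hkg with rfl | rfl
    · exact .inr hdk
    · exact .inl (by simpa using hdk)
  · exact .inr (hL.trailReach_of_step hstep hmem)

/-- The bridge obtained is an edge of `G`, which `SimpleGraph.IsBridge` alone does not require. -/
theorem exists_isBridge_of_noCompatibleCircuit [Finite V]
    (hT : ∀ v e f, T v e f → T v f e)
    (hinc : ∀ v e f, T v e f → f ∈ G.edgeSet ∧ v ∈ f)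
    (hconn : ∀ v : V, ∀ e f : Sym2 V, e ∈ G.edgeSet → v ∈ e → f ∈ G.edgeSet → v ∈ f →
      Relation.ReflTransGen (T v) e f)
    (hE : G.edgeSet.Nonempty) (hG : NoCompatibleCircuit T G) :
    ∃ e ∈ G.edgeSet, G.IsBridge e := by
  obtain ⟨e₀, he₀⟩ := hE
  induction e₀ with | _ a b
  have : Nonempty G.Dart := ⟨⟨(a, b), he₀⟩⟩
  obtain ⟨d, hd⟩ := exists_dart_forall_trailReach_symm hT hG
  have hall : ∀ m g : G.Dart, TrailReach T d m → g.snd = m.snd → TrailReach T d g := by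
    intro m g hm hg
    have key : ∀ f, Relation.ReflTransGen (T m.snd) m.edge f →
        ∃ k : G.Dart, k.edge = f ∧ k.snd = m.snd ∧ TrailReach T d k := by
      intro f hf
      induction hf with
      | refl => exact ⟨m, rfl, rfl, hm⟩
      | tail _ hbc ih =>
        obtain ⟨k, rfl, hkm, hk⟩ := ih
        obtain ⟨hc, hmc⟩ := hinc _ _ _ hbc
        obtain ⟨y, rfl⟩ := hmc
        have hadj : G.Adj y m.snd := (G.mem_edgeSet.1 hc).symm
        refine ⟨⟨(y, m.snd), hadj⟩, Sym2.eq_swap, rfl,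
          trailReach_of_transition hd hG hk ?_ hkm.symm⟩
        rw [hkm]
        simpa [Sym2.eq_swap] using hbc
    obtain ⟨k, hkg, hkm, hk⟩ := key g.edge
      (hconn _ _ _ m.edge_mem (Sym2.mem_mk_right _ _) g.edge_mem (hg ▸ Sym2.mem_mk_right _ _))
    rcases (dart_edge_eq_iff k g).1 hkg with rfl | rfl
    · exact hk
    · exact absurd (hkm.trans hg.symm) g.fst_ne_snd
  refine ⟨d.edge, d.edge_mem, ?_⟩
  change G.IsBridge s(d.fst, d.snd)
  rw [isBridge_iff, reachable_comm, reachable_iff_reflTransGen]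
  intro hr
  have key : ∀ w, Relation.ReflTransGen (G.deleteEdges {s(d.fst, d.snd)}).Adj d.snd w →
      ∃ m : G.Dart, TrailReach T d m ∧ m.snd = w := by
    intro w hw
    induction hw with
    | refl => exact ⟨d, TrailReach.refl d, rfl⟩
    | @tail x y _ hxy ih =>
      obtain ⟨m, hm, rfl⟩ := ih
      rw [deleteEdges_adj] at hxy
      let g : G.Dart := ⟨(y, m.snd), hxy.1.symm⟩
      refine ⟨g.symm, hd g (hall m g hm rfl) ?_, rfl⟩
      intro hgd
      exact hxy.2 (Sym2.eq_swap.trans (congrArg Dart.edge hgd))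
  obtain ⟨m, hm, hmd⟩ := key _ hr
  exact TrailReach.not_symm d (hall m d.symm hm hmd.symm)

end SimpleGraph

/-- If `G` is a finite graph with at least one edge, equipped with a transition
system `T` whose transition graphs `T v` (on the edges incident to `v`) are all
connected, and `G` has no compatible closed trail, then `G` has a bridge. -/
theorem stmt15 {V : Type*} [Fintype V] (G : SimpleGraph V)
    (T : V → Sym2 V → Sym2 V → Prop)
    (hsymm : ∀ v e f, T v e f → T v f e)
    (hinc : ∀ v e f, T v e f →
      e ∈ G.edgeSet ∧ f ∈ G.edgeSet ∧ v ∈ e ∧ v ∈ f ∧ e ≠ f)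
    (hconn : ∀ v : V, ∀ e f : Sym2 V,
      e ∈ G.edgeSet → v ∈ e → f ∈ G.edgeSet → v ∈ f →
      Relation.ReflTransGen (T v) e f)
    (hE : G.edgeSet.Nonempty)
    (hnt : ¬ ∃ (v : V) (C : G.Walk v v), C.IsCircuit ∧ CyclicCompatible T C) :
    ∃ e, G.IsBridge e := by
  obtain ⟨e, -, he⟩ := SimpleGraph.exists_isBridge_of_noCompatibleCircuit hsymm
    (fun v e f h => ⟨(hinc v e f h).2.1, (hinc v e f h).2.2.2.1⟩) hconn hE
    fun p L hc hn => hnt (SimpleGraph.exists_compatible_circuit_of_isChain hc hn)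
  exact ⟨e, he⟩
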